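/- arXiv:1412.2252 — 2 statements merged into one kernel-verified Lean document; each statement's English description precedes it below -/
import Mathlib

section
/- Let B be a real Banach space, let k > 0, and let q : B → B be a map with q(0) = 0 satisfying ‖q(u) − q(w)‖ ≤ k(‖u‖ + ‖w‖)·‖u − w‖ for all u, w ∈ B. Then for every v ∈ B with ‖v‖ ≤ 1/(10k) there exists a unique u ∈ B with ‖u‖ ≤ 2‖v‖ satisfying u + q(u) = v. -/
/-- Contraction-mapping lemma: for `q` with `q 0 = 0` satisfying the quadratic
Lipschitz estimate, the equation `u + q u = v` has a unique small solution. -/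
theorem stmt_0
    {B : Type*} [NormedAddCommGroup B] [NormedSpace ℝ B] [CompleteSpace B]
    (k : ℝ) (hk : 0 < k) (q : B → B) (hq0 : q 0 = 0)
    (hq : ∀ u w : B, ‖q u - q w‖ ≤ k * (‖u‖ + ‖w‖) * ‖u - w‖) :
    ∀ v : B, ‖v‖ ≤ 1 / (10 * k) →
      ∃! u : B, ‖u‖ ≤ 2 * ‖v‖ ∧ u + q u = v := by
  intro v hv
  have hkv : k * ‖v‖ ≤ 1 / 10 := by
    rw [le_div_iff₀ (by positivity)] at hv
    linarith
  have hlip : ∀ u w : B, ‖u‖ ≤ 2 * ‖v‖ → ‖w‖ ≤ 2 * ‖v‖ →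
      ‖q u - q w‖ ≤ 1 / 2 * ‖u - w‖ := by
    intro u w hu hw
    refine (hq u w).trans (mul_le_mul_of_nonneg_right ?_ (norm_nonneg _))
    have := mul_le_mul_of_nonneg_left (add_le_add hu hw) hk.le
    linarith
  have hv0 : ‖(0 : B)‖ ≤ 2 * ‖v‖ := by simp
  let s : Set B := {u | ‖u‖ ≤ 2 * ‖v‖}
  have hs : IsComplete s := (isClosed_le continuous_norm continuous_const).isComplete
  have hmaps : Set.MapsTo (fun u ↦ v - q u) s s := by
    intro u (hu : ‖u‖ ≤ 2 * ‖v‖)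
    have h := hlip u 0 hu hv0
    rw [hq0, sub_zero, sub_zero] at h
    have := norm_sub_le v (q u)
    change ‖v - q u‖ ≤ 2 * ‖v‖
    linarith
  have hcontr : ContractingWith (1 / 2) (hmaps.restrict (fun u ↦ v - q u) s s) := by
    refine ⟨by simpa using NNReal.half_lt_self one_ne_zero, LipschitzWith.of_dist_le_mul ?_⟩
    rintro ⟨u, hu⟩ ⟨w, hw⟩
    have h := hlip u w hu hw
    simpa [Subtype.dist_eq, dist_eq_norm, norm_sub_rev] using h
  obtain ⟨u, hus, hfix, -⟩ :=
    hcontr.exists_fixedPoint' hs hmaps (x := 0) hv0 (edist_ne_top _ _)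
  have hu : v - q u = u := hfix
  refine ⟨u, ⟨hus, (sub_eq_iff_eq_add.mp hu).symm⟩, ?_⟩
  rintro w ⟨hws, hw⟩
  have hfixw : v - q w = w := sub_eq_iff_eq_add.mpr hw.symm
  exact congrArg Subtype.val (hcontr.fixedPoint_unique'
    (x := (⟨w, hws⟩ : s)) (y := ⟨u, hus⟩) (Subtype.ext hfixw) (Subtype.ext hu))
end

section
/- Let B be a real Banach space, let k > 0, and let q : B → B be a map satisfying ‖q(u) − q(w)‖ ≤ k(‖u‖ + ‖w‖)·‖u − w‖ for all u, w ∈ B. Let v ∈ B. If u₁, u₂ ∈ B both satisfy uᵢ + q(uᵢ) = v and ‖u₁‖ ≤ 1/(5k) and ‖u₂‖ ≤ 1/(5k), then u₁ = u₂. -/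
/-- Uniqueness part of the contraction-mapping lemma: solutions of
`u + q u = v` are unique among elements of norm at most `1/(5k)`. -/
theorem stmt_2
    {B : Type*} [NormedAddCommGroup B] [NormedSpace ℝ B] [CompleteSpace B]
    (k : ℝ) (hk : 0 < k) (q : B → B)
    (hq : ∀ u w : B, ‖q u - q w‖ ≤ k * (‖u‖ + ‖w‖) * ‖u - w‖)
    (v : B) (u₁ u₂ : B)
    (h₁ : u₁ + q u₁ = v) (h₂ : u₂ + q u₂ = v)
    (hn₁ : ‖u₁‖ ≤ 1 / (5 * k)) (hn₂ : ‖u₂‖ ≤ 1 / (5 * k)) :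
    u₁ = u₂ := by
  have h_diff : u₁ - u₂ = q u₂ - q u₁ := by
    rw [sub_eq_sub_iff_add_eq_add, h₁, add_comm, h₂]
  have h_norm : ‖u₁ - u₂‖ ≤ k * (‖u₁‖ + ‖u₂‖) * ‖u₁ - u₂‖ := by
    calc ‖u₁ - u₂‖ = ‖q u₁ - q u₂‖ := by rw [h_diff, norm_sub_rev]
      _ ≤ _ := hq u₁ u₂
  have h_factor : k * (‖u₁‖ + ‖u₂‖) ≤ 2 / 5 := by
    calc k * (‖u₁‖ + ‖u₂‖) ≤ k * (1 / (5 * k) + 1 / (5 * k)) := by gcongr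
      _ = 2 / 5 := by field_simp; norm_num
  have h_contr : ‖u₁ - u₂‖ ≤ 2 / 5 * ‖u₁ - u₂‖ :=
    h_norm.trans (mul_le_mul_of_nonneg_right h_factor (norm_nonneg _))
  rw [← sub_eq_zero, ← norm_le_zero_iff]
  linarith
end
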